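/- Let d ∈ {3, 4}, let c > 0 be a real number, and let ε > 0. There is a constant C(c, ε) > 0 such that for every natural number m and all pairwise distinct vectors a_1, …, a_{d−1} ∈ ℤ^d with ‖a_i‖_∞ ≤ m^c for 1 ≤ i ≤ d−1, one has |(a_1 + S_{d,m}) ∩ ⋯ ∩ (a_{d−1} + S_{d,m})| ≤ C(c, ε) · m^ε. -/

import Mathlib

open Finset

noncomputable section

/-- The set of lattice points on the sphere of radius `√m` in `ℤ^d`. -/
def latSphere (d m : ℕ) : Set (Fin d → ℤ) := {x | ∑ i, x i ^ 2 = (m : ℤ)}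

theorem local_bound (ε : ℝ) (hε : 0 < ε) : ∃ A : ℝ, 1 ≤ A ∧ ∀ e : ℕ, ((e : ℝ) + 1) ≤ A * (2:ℝ) ^ (ε * e) := by
  have hl : 0 < Real.log 2 := Real.log_pos (by norm_num)
  have hk : 0 < ε * Real.log 2 := by positivity
  refine ⟨1 + 1 / (ε * Real.log 2), by linarith [one_div_pos.mpr hk], fun e => ?_⟩
  have h1 : (e : ℝ) * (ε * Real.log 2) + 1 ≤ (2:ℝ) ^ (ε * e) := by
    rw [Real.rpow_def_of_pos (by norm_num)]
    have := Real.add_one_le_exp (Real.log 2 * (ε * e))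
    linarith
  have h2 : (1 + 1 / (ε * Real.log 2)) * ((e : ℝ) * (ε * Real.log 2) + 1) =
      e * (ε * Real.log 2) + 1 + e + 1 / (ε * Real.log 2) := by
    field_simp; ring
  have h3 := mul_le_mul_of_nonneg_left h1 (by positivity : 0 ≤ (1 + 1 / (ε * Real.log 2)))
  have h4 : 0 ≤ 1 / (ε * Real.log 2) := by positivity
  have h5 : 0 ≤ (e:ℝ) * (ε * Real.log 2) := by positivity
  linarith

theorem divisor_bound (ε : ℝ) (hε : 0 < ε) :
    ∃ C : ℝ, 1 ≤ C ∧ ∀ n : ℕ, n ≠ 0 → ((#n.divisors : ℕ) : ℝ) ≤ C * (n : ℝ) ^ ε := by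
  obtain ⟨A, hA, hb⟩ := local_bound ε hε
  obtain ⟨P, hP⟩ := exists_nat_ge ((2:ℝ) ^ (1 / ε))
  refine ⟨A ^ P, one_le_pow₀ hA, fun n hn => ?_⟩
  have hn' : (n : ℝ) ^ ε = ∏ p ∈ n.primeFactors, (p : ℝ) ^ (ε * n.factorization p) := by
    conv_lhs => rw [← Nat.prod_factorization_pow_eq_self hn]
    rw [Finsupp.prod, Nat.support_factorization, Nat.cast_prod, ← Real.finsetProd_rpow]
    · refine Finset.prod_congr rfl fun p hp => ?_
      rw [Nat.cast_pow, ← Real.rpow_natCast, ← Real.rpow_mul (by positivity), mul_comm]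
    · intros; positivity
  rw [Nat.card_divisors hn, hn', Nat.cast_prod]
  have key : ∀ p ∈ n.primeFactors, ((n.factorization p + 1 : ℕ) : ℝ) ≤
      (if p < P then A else 1) * (p : ℝ) ^ (ε * n.factorization p) := by
    intro p hp
    have hp2 : (2:ℝ) ≤ p := by exact_mod_cast (Nat.prime_of_mem_primeFactors hp).two_le
    set e := n.factorization p
    push_cast
    split_ifs with h
    · refine (hb e).trans ?_
      gcongr
    · have h1 : (2:ℝ) ≤ (p:ℝ) ^ ε := by
        have : (2:ℝ) ^ (1/ε) ≤ p := hP.trans (by exact_mod_cast not_lt.mp h)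
        calc (2:ℝ) = ((2:ℝ) ^ (1/ε)) ^ ε := by
              rw [← Real.rpow_mul (by norm_num)]; field_simp; simp
          _ ≤ _ := by gcongr
      rw [one_mul, Real.rpow_mul (by positivity), Real.rpow_natCast]
      calc (e : ℝ) + 1 ≤ 2 ^ e := by exact_mod_cast Nat.lt_two_pow_self
        _ ≤ _ := by gcongr
  refine (Finset.prod_le_prod (fun _ _ => by positivity) key).trans ?_
  rw [Finset.prod_mul_distrib]
  gcongr
  rw [Finset.prod_ite, Finset.prod_const, Finset.prod_const_one, mul_one]
  refine pow_le_pow_right₀ hA ?_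
  calc _ ≤ #(Finset.range P) := Finset.card_le_card (by intro x; simp)
    _ = P := by simp

theorem isCoprime_right_of_rep {X Y Δ N : ℤ} (h : X ^ 2 + Δ * Y ^ 2 = N) (hc : IsCoprime X Y) :
    IsCoprime N Y := by
  have : IsCoprime (X ^ 2) Y := hc.pow_left
  rw [← h, show X ^ 2 + Δ * Y ^ 2 = X ^ 2 + Y * (Δ * Y) by ring]
  exact (IsCoprime.add_mul_left_left_iff).mpr this

theorem key_dvd {X0 Y0 X Y X' Y' Δ N g : ℤ} (hsq : Squarefree Δ) (hN : 0 < N)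
    (h0 : X0 ^ 2 + Δ * Y0 ^ 2 = N) (h1 : X ^ 2 + Δ * Y ^ 2 = N) (h2 : X' ^ 2 + Δ * Y' ^ 2 = N)
    (c0 : IsCoprime X0 Y0) (c1 : IsCoprime X Y)
    (hg : g = Int.gcd N (X0 * Y - X * Y0)) (hg' : g = Int.gcd N (X0 * Y' - X' * Y0)) :
    N ∣ 2 * (X * Y' - X' * Y) := by
  have n0 := isCoprime_right_of_rep h0 c0
  have n1 := isCoprime_right_of_rep h1 c1
  have hgN : g ∣ N := hg ▸ Int.gcd_dvd_left ..
  have hgD : g ∣ X0 * Y - X * Y0 := hg ▸ Int.gcd_dvd_right ..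
  have hgD' : g ∣ X0 * Y' - X' * Y0 := hg' ▸ Int.gcd_dvd_right ..
  obtain ⟨k, hk⟩ := hgN
  have hg0 : g ≠ 0 := by rintro rfl; simp at hk; omega
  have hk0 : k ≠ 0 := by rintro rfl; simp at hk; omega
  have aux : ∀ x y : ℤ, x ^ 2 + Δ * y ^ 2 = N → g = Int.gcd N (X0 * y - x * Y0) →
      k ∣ X0 * y + x * Y0 := by
    intro x y hxy hgg
    have hd : N ∣ (X0 * y - x * Y0) * (X0 * y + x * Y0) := by
      refine ⟨y ^ 2 - Y0 ^ 2, ?_⟩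
      linear_combination y ^ 2 * h0 - Y0 ^ 2 * hxy
    obtain ⟨D, hD⟩ : g ∣ X0 * y - x * Y0 := hgg ▸ Int.gcd_dvd_right ..
    rw [hD, hk, mul_assoc] at hd
    have hd' := (mul_dvd_mul_iff_left hg0).mp hd
    have hcop : IsCoprime k D := by
      rw [Int.isCoprime_iff_gcd_eq_one]
      have h3 : g = |g| * (Int.gcd k D : ℤ) := by
        conv_lhs => rw [hgg, hD, hk, Int.gcd_mul_left]
        simp
      have h4 : 0 ≤ g := by rw [hg]; positivity
      rw [abs_of_nonneg h4] at h3
      have : g * 1 = g * (Int.gcd k D : ℤ) := by linarith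
      exact_mod_cast (mul_left_cancel₀ hg0 this).symm
    exact hcop.dvd_of_dvd_mul_left hd'
  have hkS := aux X Y h1 hg
  have hkS' := aux X' Y' h2 hg'
  have hgW : g ∣ X * Y' - X' * Y := by
    have : g ∣ Y0 * (X * Y' - X' * Y) := by
      have := dvd_sub (hgD'.mul_right Y) (hgD.mul_right Y')
      obtain ⟨t, ht⟩ := this; exact ⟨t, by linear_combination ht⟩
    exact (n0.of_isCoprime_of_dvd_left ⟨k, hk⟩).dvd_of_dvd_mul_left this
  have hkW : k ∣ X * Y' - X' * Y := by
    have : k ∣ Y0 * (X * Y' - X' * Y) := by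
      have := dvd_sub (hkS.mul_right Y') (hkS'.mul_right Y)
      obtain ⟨t, ht⟩ := this; exact ⟨t, by linear_combination ht⟩
    exact (n0.of_isCoprime_of_dvd_left ⟨g, by rw [hk, mul_comm]⟩).dvd_of_dvd_mul_left this
  obtain ⟨h, hh⟩ : ∃ h : ℤ, h = Int.gcd g k := ⟨_, rfl⟩
  have hhg : h ∣ g := hh ▸ Int.gcd_dvd_left ..
  have hhk : h ∣ k := hh ▸ Int.gcd_dvd_right ..
  have hhN : h ^ 2 ∣ N := by rw [hk, sq]; exact mul_dvd_mul hhg hhk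
  have hhN1 : h ∣ N := (Dvd.intro_left (h ^ 1) (by ring)).trans hhN
  have hX : h ∣ 2 * X0 := by
    have : h ∣ Y * (2 * X0) := by
      have := dvd_add (hhg.trans hgD) (hhk.trans hkS)
      obtain ⟨t, ht⟩ := this; exact ⟨t, by linear_combination ht⟩
    exact (n1.of_isCoprime_of_dvd_left hhN1).dvd_of_dvd_mul_left this
  have hcop : IsCoprime h X0 := by
    rw [Int.isCoprime_iff_gcd_eq_one]
    obtain ⟨q, hq⟩ : ∃ q : ℤ, q = Int.gcd h X0 := ⟨_, rfl⟩
    have q1 : q ∣ h := hq ▸ Int.gcd_dvd_left ..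
    have q2 : q ∣ X0 := hq ▸ Int.gcd_dvd_right ..
    have q3 : q ^ 2 ∣ Y0 ^ 2 * Δ := by
      have := dvd_sub ((pow_dvd_pow_of_dvd q1 2).trans hhN) (pow_dvd_pow_of_dvd q2 2)
      obtain ⟨t, ht⟩ := this; exact ⟨t, by linear_combination ht + h0⟩
    have q4 : IsCoprime (q ^ 2) (Y0 ^ 2) :=
      ((n0.of_isCoprime_of_dvd_left (q1.trans hhN1)).pow)
    have q5 := q4.dvd_of_dvd_mul_left q3
    have q6 := hsq q (by rwa [← sq])
    rw [hq] at q6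
    simpa [Int.isUnit_iff_natAbs_eq] using q6
  have h2' : h ∣ 2 := hcop.dvd_of_dvd_mul_right hX
  -- lcm
  have hl : (Int.lcm g k : ℤ) ∣ X * Y' - X' * Y := Int.coe_lcm_dvd hgW hkW
  have hgl : (Int.gcd g k : ℤ) * Int.lcm g k = |N| := by
    rw [hk, Int.abs_eq_natAbs, Int.natAbs_mul]; exact_mod_cast Int.gcd_mul_lcm g k
  rw [← hh, abs_of_pos hN] at hgl
  rw [← hgl]
  exact mul_dvd_mul h2' hl

theorem prim_count {Δ N : ℤ} (hΔ : 0 < Δ) (hsq : Squarefree Δ) (hN : 0 < N)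
    (T : Finset (ℤ × ℤ)) (hT : ∀ z ∈ T, z.1 ^ 2 + Δ * z.2 ^ 2 = N ∧ IsCoprime z.1 z.2) :
    #T ≤ 25 * #N.natAbs.divisors := by
  rcases T.eq_empty_or_nonempty with rfl | ⟨z0, hz0⟩
  · simp
  obtain ⟨h0, c0⟩ := hT z0 hz0
  refine Finset.card_le_mul_card_image_of_maps_to
    (f := fun z : ℤ × ℤ => Int.gcd N (z0.1 * z.2 - z.1 * z0.2)) ?_ 25 ?_
  · intro z hz
    rw [Nat.mem_divisors]
    exact ⟨Int.natCast_dvd.mp (Int.gcd_dvd_left ..), by omega⟩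
  intro g _
  rcases (T.filter (fun z : ℤ × ℤ => Int.gcd N (z0.1 * z.2 - z.1 * z0.2) = g)).eq_empty_or_nonempty
    with he | ⟨w, hw⟩
  · rw [he]; simp
  rw [mem_filter] at hw
  obtain ⟨hw, hwg⟩ := hw
  obtain ⟨h1, c1⟩ := hT w hw
  have hcard : #((Finset.Icc (-2:ℤ) 2) ×ˢ (Finset.Icc (-2:ℤ) 2)) = 25 := by decide
  rw [← hcard]
  refine Finset.card_le_card_of_injOn (fun z : ℤ × ℤ =>
    (2 * (w.1 * z.1 + Δ * w.2 * z.2) / N, 2 * (w.1 * z.2 - z.1 * w.2) / N)) ?_ ?_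
  all_goals
    have hdv : ∀ z ∈ T.filter (fun z : ℤ × ℤ => Int.gcd N (z0.1 * z.2 - z.1 * z0.2) = g),
        ∃ u v : ℤ, 2 * (w.1 * z.1 + Δ * w.2 * z.2) = N * u ∧ 2 * (w.1 * z.2 - z.1 * w.2) = N * v
          ∧ u ^ 2 + Δ * v ^ 2 = 4 := by
      intro z hz
      rw [mem_filter] at hz
      obtain ⟨h2, c2⟩ := hT z hz.1
      obtain ⟨v, hv⟩ := key_dvd (g := g) hsq hN h0 h1 h2 c0 c1 (by rw [hwg]) (by rw [hz.2])
      have hid : (2 * (w.1 * z.1 + Δ * w.2 * z.2)) ^ 2 + Δ * (N * v) ^ 2 = 4 * N ^ 2 := by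
        rw [← hv]
        linear_combination 4 * (z.1 ^ 2 + Δ * z.2 ^ 2) * h1 + 4 * N * h2
      have hd : N ^ 2 ∣ (2 * (w.1 * z.1 + Δ * w.2 * z.2)) ^ 2 :=
        ⟨4 - Δ * v ^ 2, by linear_combination hid⟩
      obtain ⟨u, hu⟩ := (Int.pow_dvd_pow_iff (by norm_num)).mp hd
      refine ⟨u, v, hu, hv, ?_⟩
      rw [hu] at hid
      have : N ^ 2 * (u ^ 2 + Δ * v ^ 2) = N ^ 2 * 4 := by linear_combination hid
      exact mul_left_cancel₀ (by positivity) this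
  · intro z hz
    obtain ⟨u, v, hu, hv, huv⟩ := hdv z hz
    simp only [hu, hv, Int.mul_ediv_cancel_left _ hN.ne', coe_product, Set.mem_prod, coe_Icc,
      Set.mem_Icc]
    have a1 : u ^ 2 ≤ 2 ^ 2 := by nlinarith [sq_nonneg v]
    have a2 : v ^ 2 ≤ 2 ^ 2 := by nlinarith [sq_nonneg v, sq_nonneg u]
    exact ⟨abs_le.mp (abs_le_of_sq_le_sq a1 (by norm_num)),
      abs_le.mp (abs_le_of_sq_le_sq a2 (by norm_num))⟩
  · intro z hz z' hz' heq
    obtain ⟨u, v, hu, hv, huv⟩ := hdv z hz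
    obtain ⟨u', v', hu', hv', huv'⟩ := hdv z' hz'
    simp only [hu, hv, hu', hv', Int.mul_ediv_cancel_left _ hN.ne', Prod.mk.injEq] at heq
    obtain ⟨rfl, rfl⟩ := heq
    have e1 : 2 * N * z.1 = 2 * N * z'.1 := by
      linear_combination w.1 * (hu - hu') - Δ * w.2 * (hv - hv') - 2 * (z.1 - z'.1) * h1
    have e2 : 2 * N * z.2 = 2 * N * z'.2 := by
      linear_combination w.2 * (hu - hu') + w.1 * (hv - hv') - 2 * (z.2 - z'.2) * h1
    have hne : 2 * N ≠ 0 := by positivity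
    exact Prod.ext (mul_left_cancel₀ hne e1) (mul_left_cancel₀ hne e2)

theorem sqfree_count {Δ N : ℤ} (hΔ : 0 < Δ) (hsq : Squarefree Δ) (hN : 0 < N)
    (T : Finset (ℤ × ℤ)) (hT : ∀ z ∈ T, z.1 ^ 2 + Δ * z.2 ^ 2 = N) :
    #T ≤ 25 * #N.natAbs.divisors * #N.natAbs.divisors := by
  have hgp : ∀ z ∈ T, 0 < Int.gcd z.1 z.2 := by
    intro z hz
    rw [Int.gcd_pos_iff]
    by_contra! hcon
    have := hT z hz
    rw [hcon.1, hcon.2] at this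
    simp at this; omega
  have hgd : ∀ z ∈ T, (Int.gcd z.1 z.2 : ℤ) ^ 2 ∣ N := by
    intro z hz
    rw [← hT z hz]
    exact dvd_add (pow_dvd_pow_of_dvd (Int.gcd_dvd_left ..) 2)
      ((pow_dvd_pow_of_dvd (Int.gcd_dvd_right ..) 2).mul_left _)
  refine Finset.card_le_mul_card_image_of_maps_to (f := fun z : ℤ × ℤ => Int.gcd z.1 z.2) ?_ _ ?_
  · intro z hz
    rw [Nat.mem_divisors]
    exact ⟨Int.natCast_dvd.mp ((Dvd.intro_left (_ ^ 1) (by ring)).trans (hgd z hz)), by omega⟩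
  intro e _
  rcases (T.filter (fun z : ℤ × ℤ => Int.gcd z.1 z.2 = e)).eq_empty_or_nonempty
    with he | ⟨w, hw⟩
  · rw [he]; simp
  rw [mem_filter] at hw
  have he0 : 0 < e := hw.2 ▸ hgp w hw.1
  obtain ⟨M, hM⟩ : (e : ℤ) ^ 2 ∣ N := hw.2 ▸ hgd w hw.1
  have hez : (0 : ℤ) < e := by exact_mod_cast he0
  have hM0 : 0 < M := by
    by_contra! hc
    have : (e : ℤ) ^ 2 * M ≤ 0 := mul_nonpos_of_nonneg_of_nonpos (by positivity) hc
    omega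
  have hex : ∀ z ∈ T.filter (fun z : ℤ × ℤ => Int.gcd z.1 z.2 = e),
      ∃ x y : ℤ, z.1 = e * x ∧ z.2 = e * y ∧ x ^ 2 + Δ * y ^ 2 = M ∧ IsCoprime x y := by
    intro z hz
    rw [mem_filter] at hz
    obtain ⟨x, hx⟩ : (e : ℤ) ∣ z.1 := hz.2 ▸ Int.gcd_dvd_left ..
    obtain ⟨y, hy⟩ : (e : ℤ) ∣ z.2 := hz.2 ▸ Int.gcd_dvd_right ..
    refine ⟨x, y, hx, hy, ?_, ?_⟩
    · have := hT z hz.1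
      rw [hx, hy, hM] at this
      have h3 : (e : ℤ) ^ 2 * (x ^ 2 + Δ * y ^ 2) = e ^ 2 * M := by linear_combination this
      exact mul_left_cancel₀ (by positivity) h3
    · rw [Int.isCoprime_iff_gcd_eq_one]
      have := hz.2
      rw [hx, hy, Int.gcd_mul_left, Int.natAbs_natCast] at this
      exact Nat.eq_of_mul_eq_mul_left he0 (by rw [this, mul_one])
  have hinj : Set.InjOn (fun z : ℤ × ℤ => (z.1 / (e : ℤ), z.2 / (e : ℤ)))
      (T.filter (fun z : ℤ × ℤ => Int.gcd z.1 z.2 = e)) := by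
    intro z hz z' hz' heq
    obtain ⟨x, y, hx, hy, -⟩ := hex z hz
    obtain ⟨x', y', hx', hy', -⟩ := hex z' hz'
    simp only [hx, hy, hx', hy', Int.mul_ediv_cancel_left _ hez.ne', Prod.mk.injEq] at heq
    exact Prod.ext (by rw [hx, hx', heq.1]) (by rw [hy, hy', heq.2])
  rw [← Finset.card_image_of_injOn hinj]
  refine (prim_count hΔ hsq hM0 _ ?_).trans ?_
  · intro z' hz'
    rw [mem_image] at hz'
    obtain ⟨z, hz, rfl⟩ := hz'
    obtain ⟨x, y, hx, hy, h1, h2⟩ := hex z hz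
    simp only [hx, hy, Int.mul_ediv_cancel_left _ hez.ne']
    exact ⟨h1, h2⟩
  · refine Nat.mul_le_mul_left _ (Finset.card_le_card (Nat.divisors_subset_of_dvd (by omega) ?_))
    exact Int.natAbs_dvd_natAbs.mpr ⟨_, by rw [hM, mul_comm]⟩

theorem rep_count {Δ N : ℤ} (hΔ : 0 < Δ) (hN : 0 < N)
    (T : Finset (ℤ × ℤ)) (hT : ∀ z ∈ T, z.1 ^ 2 + Δ * z.2 ^ 2 = N) :
    #T ≤ 25 * #N.natAbs.divisors * #N.natAbs.divisors := by
  lift Δ to ℕ using hΔ.le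
  obtain ⟨a, b, ha, hb, hab, hs⟩ := Nat.sq_mul_squarefree_of_pos (n := Δ) (by exact_mod_cast hΔ)
  have hbz : (b : ℤ) ≠ 0 := by positivity
  have hinj : Function.Injective (fun z : ℤ × ℤ => (z.1, (b : ℤ) * z.2)) := by
    intro z z' h
    simp only [Prod.mk.injEq] at h
    exact Prod.ext h.1 (mul_left_cancel₀ hbz h.2)
  rw [← Finset.card_image_of_injective T hinj]
  refine sqfree_count (Δ := a) (by exact_mod_cast ha) (Int.squarefree_natCast.mpr hs) hN _ ?_
  intro z' hz'
  rw [mem_image] at hz'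
  obtain ⟨z, hz, rfl⟩ := hz'
  rw [← hT z hz, ← hab]
  push_cast; ring

theorem abs_mul_bd {a b A B : ℤ} (ha : |a| ≤ A) (hb : |b| ≤ B) : |a * b| ≤ A * B := by
  rw [abs_mul]; exact mul_le_mul ha hb (abs_nonneg _) ((abs_nonneg _).trans ha)

theorem conic_bound (ε : ℝ) (hε : 0 < ε) : ∃ C : ℝ, 0 < C ∧ ∀ K : ℤ, 1 ≤ K →
    ∀ A B G D E F : ℤ, |A| ≤ K → |B| ≤ K → |G| ≤ K → |D| ≤ K → |E| ≤ K → |F| ≤ K →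
    0 < 4 * A * G - B ^ 2 → ∀ T : Finset (ℤ × ℤ),
    (∀ z ∈ T, A * z.1 ^ 2 + B * z.1 * z.2 + G * z.2 ^ 2 + D * z.1 + E * z.2 + F = 0) →
    (#T : ℝ) ≤ C * (K : ℝ) ^ ε := by
  obtain ⟨C1, hC1, hdiv⟩ := divisor_bound (ε / 8) (by positivity)
  refine ⟨25 * C1 ^ 2 * (34 : ℝ) ^ (ε / 4), by positivity, ?_⟩
  intro K hK A B G D E F hA hB hG hD hE hF hpos T hT
  have hKr : (1 : ℝ) ≤ K := by exact_mod_cast hK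
  have hA0 : A ≠ 0 := by
    rintro rfl
    nlinarith [sq_nonneg B]
  obtain ⟨δ, hδ⟩ : ∃ δ, δ = 4 * A * G - B ^ 2 := ⟨_, rfl⟩
  obtain ⟨e, he⟩ : ∃ e, e = 2 * A * E - B * D := ⟨_, rfl⟩
  obtain ⟨f, hf⟩ : ∃ f, f = 4 * A * F - D ^ 2 := ⟨_, rfl⟩
  rw [← hδ] at hpos
  have bA := abs_le.mp (abs_mul_bd hA hG)
  have bδ : |δ| ≤ 5 * K ^ 2 := by
    have h1 := abs_le.mp (abs_mul_bd hA hG)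
    have h2 := abs_le.mp (abs_mul_bd hB hB)
    rw [hδ, abs_le]; constructor <;> nlinarith
  have be : |e| ≤ 3 * K ^ 2 := by
    have h1 := abs_le.mp (abs_mul_bd hA hE)
    have h2 := abs_le.mp (abs_mul_bd hB hD)
    rw [he, abs_le]; constructor <;> nlinarith
  have bf : |f| ≤ 5 * K ^ 2 := by
    have h1 := abs_le.mp (abs_mul_bd hA hF)
    have h2 := abs_le.mp (abs_mul_bd hD hD)
    rw [hf, abs_le]; constructor <;> nlinarith
  obtain ⟨N, hN⟩ : ∃ N, N = e ^ 2 - δ * f := ⟨_, rfl⟩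
  have bN : N ≤ 34 * K ^ 4 := by
    have h1 := abs_le.mp (abs_mul_bd be be)
    have h2 := abs_le.mp (abs_mul_bd bδ bf)
    rw [hN]; nlinarith
  have hinj : Function.Injective
      (fun z : ℤ × ℤ => (δ * z.2 + e, 2 * A * z.1 + B * z.2 + D)) := by
    intro z z' h
    simp only [Prod.mk.injEq] at h
    have h2 : z.2 = z'.2 := mul_left_cancel₀ hpos.ne' (by linarith [h.1] : δ * z.2 = δ * z'.2)
    have h1 : (2 * A) * z.1 = (2 * A) * z'.1 := by
      have := h.2; rw [h2] at this; linarith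
    exact Prod.ext (mul_left_cancel₀ (by simpa using hA0) h1) h2
  have hT' : ∀ z ∈ T.image (fun z : ℤ × ℤ => (δ * z.2 + e, 2 * A * z.1 + B * z.2 + D)),
      z.1 ^ 2 + δ * z.2 ^ 2 = N := by
    intro z' hz'
    rw [mem_image] at hz'
    obtain ⟨z, hz, rfl⟩ := hz'
    have := hT z hz
    simp only
    rw [hN, he, hf, hδ]
    linear_combination 4 * A * (4 * A * G - B ^ 2) * this
  rw [← Finset.card_image_of_injective T hinj]
  set S := T.image (fun z : ℤ × ℤ => (δ * z.2 + e, 2 * A * z.1 + B * z.2 + D))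
  have hone : (1 : ℝ) ≤ 25 * C1 ^ 2 * (34 : ℝ) ^ (ε / 4) * (K : ℝ) ^ ε := by
    have h1 : (1 : ℝ) ≤ C1 ^ 2 := one_le_pow₀ hC1
    have h2 : (1 : ℝ) ≤ (34 : ℝ) ^ (ε / 4) := Real.one_le_rpow (by norm_num) (by positivity)
    have h3 : (1 : ℝ) ≤ (K : ℝ) ^ ε := Real.one_le_rpow hKr hε.le
    have h4 := one_le_mul_of_one_le_of_one_le h1 h2
    have h5 := one_le_mul_of_one_le_of_one_le h4 h3
    linarith
  rcases le_or_gt N 0 with hN0 | hN0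
  · have : #S ≤ 1 := by
      rw [Finset.card_le_one]
      have h0 : ∀ z ∈ S, z = (0, 0) := by
        intro z hz
        have h1 := hT' z hz
        have h2 : 0 ≤ δ * z.2 ^ 2 := by positivity
        have h3 : z.1 ^ 2 = 0 := by nlinarith [sq_nonneg z.1]
        have h4 : δ * z.2 ^ 2 = 0 := by nlinarith [sq_nonneg z.1]
        have h5 : z.2 ^ 2 = 0 := by simpa [hpos.ne'] using h4
        exact Prod.ext (by simpa using h3) (by simpa using h5)
      intro a ha b hb
      rw [h0 a ha, h0 b hb]
    exact le_trans (by exact_mod_cast this) hone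
  · have h1 := rep_count hpos hN0 S hT'
    have h2 := hdiv N.natAbs (by omega)
    have hNr : ((N.natAbs : ℕ) : ℝ) = (N : ℝ) := by
      rw [Nat.cast_natAbs, abs_of_pos hN0]
    have hNp : (0 : ℝ) < N := by exact_mod_cast hN0
    have bN' : (N : ℝ) ≤ 34 * (K : ℝ) ^ 4 := by exact_mod_cast bN
    rw [hNr] at h2
    have h3 : (#S : ℝ) ≤ 25 * (#N.natAbs.divisors : ℝ) * (#N.natAbs.divisors : ℝ) := by
      exact_mod_cast h1
    calc (#S : ℝ) ≤ 25 * (#N.natAbs.divisors : ℝ) * (#N.natAbs.divisors : ℝ) := h3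
      _ ≤ 25 * (C1 * (N : ℝ) ^ (ε / 8)) * (C1 * (N : ℝ) ^ (ε / 8)) := by gcongr
      _ = 25 * C1 ^ 2 * ((N : ℝ) ^ (ε / 8) * (N : ℝ) ^ (ε / 8)) := by ring
      _ = 25 * C1 ^ 2 * (N : ℝ) ^ (ε / 4) := by
          rw [← Real.rpow_add hNp]; congr 2; ring
      _ ≤ 25 * C1 ^ 2 * (34 * (K : ℝ) ^ 4) ^ (ε / 4) := by gcongr
      _ = 25 * C1 ^ 2 * (34 : ℝ) ^ (ε / 4) * (K : ℝ) ^ ε := by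
          rw [Real.mul_rpow (by norm_num) (by positivity), ← Real.rpow_natCast (K : ℝ) 4,
            ← Real.rpow_mul (by positivity)]
          have h4 : ((4 : ℕ) : ℝ) * (ε / 4) = ε := by push_cast; ring
          rw [h4]; ring

theorem plane_bound (ε : ℝ) (hε : 0 < ε) : ∃ C : ℝ, 0 < C ∧ ∀ H : ℤ, 1 ≤ H →
    ∀ (b b' : Fin 4 → ℤ) (n n' m : ℤ), (∀ i, |b i| ≤ H) → (∀ i, |b' i| ≤ H) → |n| ≤ H →
    |n'| ≤ H → |m| ≤ H → b 2 * b' 3 - b 3 * b' 2 ≠ 0 → ∀ T : Finset (Fin 4 → ℤ),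
    (∀ y ∈ T, ∑ i, b i * y i = n ∧ ∑ i, b' i * y i = n' ∧ ∑ i, y i ^ 2 = m) →
    (#T : ℝ) ≤ C * (H : ℝ) ^ ε := by
  obtain ⟨C1, hC1, hcon⟩ := conic_bound (ε / 6) (by positivity)
  refine ⟨C1 * (32 : ℝ) ^ (ε / 6), by positivity, ?_⟩
  intro H hH b b' n n' m hb hb' hn hn' hm hM T hT
  have hHr : (1 : ℝ) ≤ H := by exact_mod_cast hH
  have mb : ∀ s t u v : ℤ, |s| ≤ H → |t| ≤ H → |u| ≤ H → |v| ≤ H →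
      |s * t - u * v| ≤ 2 * H ^ 2 := by
    intro s t u v hs ht hu hv
    have h1 := abs_le.mp (abs_mul_bd hs ht)
    have h2 := abs_le.mp (abs_mul_bd hu hv)
    rw [abs_le]; constructor <;> nlinarith
  obtain ⟨G, hG⟩ : ∃ G, G = 2 * H ^ 2 := ⟨_, rfl⟩
  have hG1 : 1 ≤ G := by rw [hG]; nlinarith
  have hGm : |m| ≤ G := by rw [hG]; nlinarith
  rw [← hG] at mb
  obtain ⟨M, hMd⟩ : ∃ M, M = b 2 * b' 3 - b 3 * b' 2 := ⟨_, rfl⟩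
  obtain ⟨α0, hα0⟩ : ∃ x, x = b' 3 * n - b 3 * n' := ⟨_, rfl⟩
  obtain ⟨α1, hα1⟩ : ∃ x, x = b 3 * b' 0 - b' 3 * b 0 := ⟨_, rfl⟩
  obtain ⟨α2, hα2⟩ : ∃ x, x = b 3 * b' 1 - b' 3 * b 1 := ⟨_, rfl⟩
  obtain ⟨β0, hβ0⟩ : ∃ x, x = b 2 * n' - b' 2 * n := ⟨_, rfl⟩
  obtain ⟨β1, hβ1⟩ : ∃ x, x = b' 2 * b 0 - b 2 * b' 0 := ⟨_, rfl⟩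
  obtain ⟨β2, hβ2⟩ : ∃ x, x = b' 2 * b 1 - b 2 * b' 1 := ⟨_, rfl⟩
  have bM : |M| ≤ G := hMd ▸ mb _ _ _ _ (hb _) (hb' _) (hb _) (hb' _)
  have bα0 : |α0| ≤ G := hα0 ▸ mb _ _ _ _ (hb' _) hn (hb _) hn'
  have bα1 : |α1| ≤ G := hα1 ▸ mb _ _ _ _ (hb _) (hb' _) (hb' _) (hb _)
  have bα2 : |α2| ≤ G := hα2 ▸ mb _ _ _ _ (hb _) (hb' _) (hb' _) (hb _)
  have bβ0 : |β0| ≤ G := hβ0 ▸ mb _ _ _ _ (hb _) hn' (hb' _) hn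
  have bβ1 : |β1| ≤ G := hβ1 ▸ mb _ _ _ _ (hb' _) (hb _) (hb _) (hb' _)
  have bβ2 : |β2| ≤ G := hβ2 ▸ mb _ _ _ _ (hb' _) (hb _) (hb _) (hb' _)
  rw [← hMd] at hM
  have hlin : ∀ y ∈ T, M * y 2 = α0 + α1 * y 0 + α2 * y 1 ∧ M * y 3 = β0 + β1 * y 0 + β2 * y 1
      ∧ y 0 ^ 2 + y 1 ^ 2 + y 2 ^ 2 + y 3 ^ 2 = m := by
    intro y hy
    obtain ⟨h1, h2, h3⟩ := hT y hy
    simp only [Fin.sum_univ_four] at h1 h2 h3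
    refine ⟨?_, ?_, h3⟩
    · rw [hMd, hα0, hα1, hα2]; linear_combination b' 3 * h1 - b 3 * h2
    · rw [hMd, hβ0, hβ1, hβ2]; linear_combination b 2 * h2 - b' 2 * h1
  have hinj : Set.InjOn (fun y : Fin 4 → ℤ => (y 0, y 1)) T := by
    intro y hy y' hy' h
    simp only [Prod.mk.injEq] at h
    obtain ⟨p1, p2, -⟩ := hlin y hy
    obtain ⟨q1, q2, -⟩ := hlin y' hy'
    have e2 : y 2 = y' 2 := mul_left_cancel₀ hM (by rw [p1, q1, h.1, h.2])
    have e3 : y 3 = y' 3 := mul_left_cancel₀ hM (by rw [p2, q2, h.1, h.2])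
    funext i
    fin_cases i
    exacts [h.1, h.2, e2, e3]
  have b2 : ∀ s t : ℤ, |s| ≤ G → |t| ≤ G → -G ^ 2 ≤ s * t ∧ s * t ≤ G ^ 2 := by
    intro s t hs ht
    have := abs_le.mp (abs_mul_bd hs ht)
    rwa [← sq] at this
  have hG23 : G ^ 2 ≤ G ^ 3 := pow_le_pow_right₀ hG1 (by norm_num)
  have hG0 : 0 ≤ G ^ 2 := by positivity
  rw [← Finset.card_image_of_injOn hinj]
  have hK : (1 : ℤ) ≤ 32 * H ^ 6 := by have := one_le_pow₀ hH (n := 6); linarith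
  have hKG : 32 * H ^ 6 = 4 * G ^ 3 := by rw [hG]; ring
  refine (hcon (32 * H ^ 6) hK (M ^ 2 + α1 ^ 2 + β1 ^ 2) (2 * (α1 * α2 + β1 * β2))
    (M ^ 2 + α2 ^ 2 + β2 ^ 2) (2 * (α0 * α1 + β0 * β1)) (2 * (α0 * α2 + β0 * β2))
    (α0 ^ 2 + β0 ^ 2 - m * M ^ 2) ?_ ?_ ?_ ?_ ?_ ?_ ?_ _ ?_).trans ?_
  · have := b2 _ _ bM bM; have := b2 _ _ bα1 bα1; have := b2 _ _ bβ1 bβ1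
    rw [hKG, abs_le]; constructor <;> linarith
  · have := b2 _ _ bα1 bα2; have := b2 _ _ bβ1 bβ2
    rw [hKG, abs_le]; constructor <;> linarith
  · have := b2 _ _ bM bM; have := b2 _ _ bα2 bα2; have := b2 _ _ bβ2 bβ2
    rw [hKG, abs_le]; constructor <;> linarith
  · have := b2 _ _ bα0 bα1; have := b2 _ _ bβ0 bβ1
    rw [hKG, abs_le]; constructor <;> linarith
  · have := b2 _ _ bα0 bα2; have := b2 _ _ bβ0 bβ2
    rw [hKG, abs_le]; constructor <;> linarith
  · have := b2 _ _ bα0 bα0; have := b2 _ _ bβ0 bβ0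
    have := abs_le.mp (abs_mul_bd hGm (abs_mul_bd bM bM))
    rw [hKG, abs_le]; constructor <;> linarith
  · have hM2 : 0 < M ^ 2 := by positivity
    have : 4 * (M ^ 2 + α1 ^ 2 + β1 ^ 2) * (M ^ 2 + α2 ^ 2 + β2 ^ 2)
        - (2 * (α1 * α2 + β1 * β2)) ^ 2 = 4 * M ^ 2 * M ^ 2
        + 4 * M ^ 2 * (α1 ^ 2 + β1 ^ 2 + α2 ^ 2 + β2 ^ 2) + 4 * (α1 * β2 - α2 * β1) ^ 2 := by ring
    rw [this]; positivity
  · intro z hz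
    rw [mem_image] at hz
    obtain ⟨y, hy, rfl⟩ := hz
    obtain ⟨p1, p2, p3⟩ := hlin y hy
    simp only
    linear_combination M ^ 2 * p3 - (M * y 2 + (α0 + α1 * y 0 + α2 * y 1)) * p1
      - (M * y 3 + (β0 + β1 * y 0 + β2 * y 1)) * p2
  · push_cast
    rw [Real.mul_rpow (by norm_num) (by positivity), ← Real.rpow_natCast (H : ℝ) 6,
      ← Real.rpow_mul (by positivity), mul_assoc]
    apply le_of_eq
    congr 3
    push_cast; ring

theorem plane_bound_gen (ε : ℝ) (hε : 0 < ε) : ∃ C : ℝ, 0 < C ∧ ∀ H : ℤ, 1 ≤ H →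
    ∀ (b b' : Fin 4 → ℤ) (n n' m : ℤ), (∀ i, |b i| ≤ H) → (∀ i, |b' i| ≤ H) → |n| ≤ H →
    |n'| ≤ H → |m| ≤ H → (∃ i j, b i * b' j - b j * b' i ≠ 0) → ∀ T : Finset (Fin 4 → ℤ),
    (∀ y ∈ T, ∑ i, b i * y i = n ∧ ∑ i, b' i * y i = n' ∧ ∑ i, y i ^ 2 = m) →
    (#T : ℝ) ≤ C * (H : ℝ) ^ ε := by
  obtain ⟨C1, hC1, hcon⟩ := plane_bound ε hε
  refine ⟨C1, hC1, ?_⟩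
  rintro H hH b b' n n' m hb hb' hn hn' hm ⟨i, j, hij⟩ T hT
  have hne : i ≠ j := by rintro rfl; apply hij; ring
  obtain ⟨σ, h2, h3⟩ : ∃ σ : Equiv.Perm (Fin 4), σ 2 = i ∧ σ 3 = j := by
    revert hne; clear hij; revert i j; decide
  have hinj : Function.Injective (fun y : Fin 4 → ℤ => y ∘ σ) := σ.surjective.injective_comp_right
  rw [← Finset.card_image_of_injective T hinj]
  refine hcon H hH (b ∘ σ) (b' ∘ σ) n n' m (fun _ => hb _) (fun _ => hb' _) hn hn' hm
    (by simpa [h2, h3] using hij) _ ?_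
  intro z hz
  rw [mem_image] at hz
  obtain ⟨y, hy, rfl⟩ := hz
  obtain ⟨h1, h2, h3⟩ := hT y hy
  simp only [Function.comp]
  exact ⟨(Equiv.sum_comp σ (fun i => b i * y i)).trans h1,
    (Equiv.sum_comp σ (fun i => b' i * y i)).trans h2,
    (Equiv.sum_comp σ (fun i => y i ^ 2)).trans h3⟩

theorem mem_inter_iff' {d m k : ℕ} (a : Fin k → Fin d → ℤ) (x : Fin d → ℤ) :
    x ∈ (⋂ i, (fun y => a i + y) '' latSphere d m) ↔ ∀ i, ∑ j, (x j - a i j) ^ 2 = (m : ℤ) := by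
  rw [Set.mem_iInter]
  refine forall_congr' fun i => ?_
  constructor
  · rintro ⟨y, hy, rfl⟩
    simpa [latSphere] using hy
  · intro h
    exact ⟨x - a i, by simpa [latSphere] using h, by simp⟩

/-- The bisecting hyperplane of two centres. -/
theorem bisector {k : ℕ} {m : ℤ} {x a a' : Fin k → ℤ} (h : ∑ j, (x j - a j) ^ 2 = m)
    (h' : ∑ j, (x j - a' j) ^ 2 = m) :
    ∑ j, (2 * (a' j - a j)) * (x j - a j) = ∑ j, (a' j - a j) ^ 2 := by
  have : ∑ j, ((x j - a j) ^ 2 - (x j - a' j) ^ 2) = 0 := by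
    rw [Finset.sum_sub_distrib, h, h', sub_self]
  have h2 : ∑ j, ((2 * (a' j - a j)) * (x j - a j) - (a' j - a j) ^ 2) = 0 := by
    rw [← this]; refine Finset.sum_congr rfl fun j _ => by ring
  rw [Finset.sum_sub_distrib] at h2
  linarith

/-- Points equidistant from three distinct points: these are not collinear. -/
theorem minor_ne {k : ℕ} {b b' y : Fin k → ℤ} (hb : b ≠ 0) (hb' : b' ≠ 0) (hne : b ≠ b')
    (h : ∑ j, (2 * b j) * y j = ∑ j, b j ^ 2) (h' : ∑ j, (2 * b' j) * y j = ∑ j, b' j ^ 2) :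
    ∃ i j, (2 * b i) * (2 * b' j) - (2 * b j) * (2 * b' i) ≠ 0 := by
  by_contra! hcon
  have hpar : ∀ i, b i * ∑ j, b' j ^ 2 = b' i * ∑ j, b j ^ 2 := by
    intro i
    rw [← h, ← h', Finset.mul_sum, Finset.mul_sum]
    refine Finset.sum_congr rfl fun j _ => ?_
    have : b i * b' j = b j * b' i := by linarith [hcon i j]
    linear_combination 2 * y j * this
  have pos : ∀ v : Fin k → ℤ, v ≠ 0 → 0 < ∑ j, v j ^ 2 := by
    intro v hv
    obtain ⟨i, hi⟩ := Function.ne_iff.mp hv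
    refine Finset.sum_pos' (fun _ _ => sq_nonneg _) ⟨i, Finset.mem_univ _, ?_⟩
    have : v i ≠ 0 := hi
    positivity
  have p := pos b hb
  have p' := pos b' hb'
  obtain ⟨s, hs⟩ : ∃ s, s = ∑ j, b j ^ 2 := ⟨_, rfl⟩
  obtain ⟨t, ht⟩ : ∃ t, t = ∑ j, b' j ^ 2 := ⟨_, rfl⟩
  rw [← hs] at p
  rw [← ht] at p'
  simp only [← hs, ← ht] at hpar
  have hsq : s * t ^ 2 = t * s ^ 2 := by
    conv_lhs => rw [hs]
    conv_rhs => rw [ht]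
    rw [Finset.sum_mul, Finset.sum_mul]
    refine Finset.sum_congr rfl fun j _ => ?_
    rw [← mul_pow, ← mul_pow, hpar]
  have hst : t = s := by
    have : (s * t) * t = (s * t) * s := by linear_combination hsq
    exact mul_left_cancel₀ (by positivity) this
  apply hne
  funext i
  have := hpar i
  rw [hst] at this
  exact mul_right_cancel₀ p.ne' this

theorem height_bounds (c : ℝ) (hc : 0 < c) (m : ℕ) (hm : 1 ≤ m) :
    ∃ H : ℤ, 1 ≤ H ∧ (H : ℝ) ≤ 17 * (m : ℝ) ^ (2 * c + 1) ∧ |(m : ℤ)| ≤ H ∧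
      (∀ u v : ℤ, ((|u| : ℤ) : ℝ) ≤ (m : ℝ) ^ c → ((|v| : ℤ) : ℝ) ≤ (m : ℝ) ^ c →
        |2 * (u - v)| ≤ H) ∧
      (∀ k : ℕ, k ≤ 4 → ∀ u v : Fin k → ℤ, (∀ i, ((|u i| : ℤ) : ℝ) ≤ (m : ℝ) ^ c) →
        (∀ i, ((|v i| : ℤ) : ℝ) ≤ (m : ℝ) ^ c) → |∑ i, (u i - v i) ^ 2| ≤ H) := by
  have hmr : (1 : ℝ) ≤ m := by exact_mod_cast hm
  have p1 : (1 : ℝ) ≤ (m : ℝ) ^ (2 * c + 1) := Real.one_le_rpow hmr (by linarith)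
  have p2 : (m : ℝ) ≤ (m : ℝ) ^ (2 * c + 1) := by
    conv_lhs => rw [← Real.rpow_one (m : ℝ)]
    exact Real.rpow_le_rpow_of_exponent_le hmr (by linarith)
  have p3 : (m : ℝ) ^ c ≤ (m : ℝ) ^ (2 * c + 1) :=
    Real.rpow_le_rpow_of_exponent_le hmr (by linarith)
  have p4 : ((m : ℝ) ^ c) ^ 2 ≤ (m : ℝ) ^ (2 * c + 1) := by
    rw [← Real.rpow_natCast, ← Real.rpow_mul (by positivity)]
    exact Real.rpow_le_rpow_of_exponent_le hmr (by push_cast; linarith)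
  refine ⟨⌊17 * (m : ℝ) ^ (2 * c + 1)⌋, ?_, Int.floor_le _, ?_, ?_, ?_⟩
  · rw [Int.le_floor]; push_cast; linarith
  · rw [Int.le_floor]; simp; linarith
  · intro u v hu hv
    rw [Int.le_floor]
    push_cast at hu hv ⊢
    rw [abs_le] at *
    constructor <;> linarith
  · intro k hk u v hu hv
    rw [Int.le_floor]
    push_cast
    rw [abs_of_nonneg (Finset.sum_nonneg fun _ _ => sq_nonneg _)]
    have : ∀ i ∈ (Finset.univ : Finset (Fin k)), ((u i : ℝ) - v i) ^ 2 ≤ 4 * ((m : ℝ) ^ c) ^ 2 := by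
      intro i _
      have h1 := hu i
      have h2 := hv i
      push_cast at h1 h2
      have h3 : |(u i : ℝ) - v i| ≤ 2 * (m : ℝ) ^ c := by
        rw [abs_le] at *
        constructor <;> linarith
      calc ((u i : ℝ) - v i) ^ 2 ≤ (2 * (m : ℝ) ^ c) ^ 2 := sq_le_sq' (abs_le.mp h3).1 (abs_le.mp h3).2
        _ = _ := by ring
    refine (Finset.sum_le_card_nsmul _ _ _ this).trans ?_
    simp only [Finset.card_univ, Fintype.card_fin, nsmul_eq_mul]
    have hk' : (k : ℝ) ≤ 4 := by exact_mod_cast hk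
    have : (k : ℝ) * (4 * ((m : ℝ) ^ c) ^ 2) ≤ 4 * (4 * ((m : ℝ) ^ c) ^ 2) := by gcongr
    linarith

theorem four_case (m : ℕ) (a : Fin 3 → Fin 4 → ℤ) (ha : Function.Injective a)
    (ε C : ℝ) (hC : 0 < C) (H : ℤ) (hH : 1 ≤ H)
    (hP : ∀ (b b' : Fin 4 → ℤ) (n n' m : ℤ), (∀ i, |b i| ≤ H) → (∀ i, |b' i| ≤ H) → |n| ≤ H →
    |n'| ≤ H → |m| ≤ H → (∃ i j, b i * b' j - b j * b' i ≠ 0) → ∀ T : Finset (Fin 4 → ℤ),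
    (∀ y ∈ T, ∑ i, b i * y i = n ∧ ∑ i, b' i * y i = n' ∧ ∑ i, y i ^ 2 = m) →
    (#T : ℝ) ≤ C * (H : ℝ) ^ ε)
    (hm : |(m : ℤ)| ≤ H) (h1 : ∀ i i' j, |2 * (a i j - a i' j)| ≤ H)
    (h2 : ∀ i i', |∑ j, (a i j - a i' j) ^ 2| ≤ H) (T : Finset (Fin 4 → ℤ))
    (hT : ∀ x ∈ T, ∀ i, ∑ j, (x j - a i j) ^ 2 = (m : ℤ)) : (#T : ℝ) ≤ C * (H : ℝ) ^ ε := by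
  rcases T.eq_empty_or_nonempty with rfl | ⟨x0, hx0⟩
  · have : (0 : ℝ) ≤ H := by exact_mod_cast (by omega : 0 ≤ H)
    simp; positivity
  have hinj : Function.Injective (fun x : Fin 4 → ℤ => x - a 0) := sub_left_injective
  rw [← Finset.card_image_of_injective T hinj]
  refine hP (fun j => 2 * (a 1 j - a 0 j)) (fun j => 2 * (a 2 j - a 0 j))
    (∑ j, (a 1 j - a 0 j) ^ 2) (∑ j, (a 2 j - a 0 j) ^ 2) m (h1 1 0) (h1 2 0) (h2 1 0) (h2 2 0) hm
    ?_ _ ?_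
  · refine minor_ne (b := a 1 - a 0) (b' := a 2 - a 0) (y := x0 - a 0) ?_ ?_ ?_
      (bisector (hT x0 hx0 0) (hT x0 hx0 1)) (bisector (hT x0 hx0 0) (hT x0 hx0 2))
    · exact sub_ne_zero.mpr (ha.ne (by decide))
    · exact sub_ne_zero.mpr (ha.ne (by decide))
    · exact fun h => ha.ne (by decide : (1 : Fin 3) ≠ 2) (sub_left_injective h)
  · intro z hz
    rw [mem_image] at hz
    obtain ⟨x, hx, rfl⟩ := hz
    exact ⟨bisector (hT x hx 0) (hT x hx 1), bisector (hT x hx 0) (hT x hx 2), hT x hx 0⟩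

theorem three_case (m : ℕ) (a : Fin 2 → Fin 3 → ℤ) (ha : Function.Injective a)
    (ε C : ℝ) (H : ℤ) (hH : 1 ≤ H)
    (hP : ∀ (b b' : Fin 4 → ℤ) (n n' m : ℤ), (∀ i, |b i| ≤ H) → (∀ i, |b' i| ≤ H) → |n| ≤ H →
    |n'| ≤ H → |m| ≤ H → (∃ i j, b i * b' j - b j * b' i ≠ 0) → ∀ T : Finset (Fin 4 → ℤ),
    (∀ y ∈ T, ∑ i, b i * y i = n ∧ ∑ i, b' i * y i = n' ∧ ∑ i, y i ^ 2 = m) →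
    (#T : ℝ) ≤ C * (H : ℝ) ^ ε)
    (hm : |(m : ℤ)| ≤ H) (h1 : ∀ i i' j, |2 * (a i j - a i' j)| ≤ H)
    (h2 : ∀ i i', |∑ j, (a i j - a i' j) ^ 2| ≤ H) (T : Finset (Fin 3 → ℤ))
    (hT : ∀ x ∈ T, ∀ i, ∑ j, (x j - a i j) ^ 2 = (m : ℤ)) : (#T : ℝ) ≤ C * (H : ℝ) ^ ε := by
  have hinj : Function.Injective
      (fun x : Fin 3 → ℤ => (Fin.snoc (α := fun _ => ℤ) (x - a 0) 0 : Fin 4 → ℤ)) := by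
    intro x x' h
    exact sub_left_injective (Fin.snoc_inj.mp h).1
  rw [← Finset.card_image_of_injective T hinj]
  refine hP (Fin.snoc (α := fun _ => ℤ) (fun j => 2 * (a 1 j - a 0 j)) 0)
    (Fin.snoc (α := fun _ => ℤ) (fun _ : Fin 3 => 0) 1)
    (∑ j, (a 1 j - a 0 j) ^ 2) 0 m ?_ ?_ (h2 1 0) (by simp; omega) hm ?_ _ ?_
  · refine Fin.lastCases ?_ ?_
    · rw [Fin.snoc_last]; simp; omega
    · intro i; rw [Fin.snoc_castSucc]; exact h1 1 0 i
  · refine Fin.lastCases ?_ ?_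
    · rw [Fin.snoc_last]; simp; omega
    · intro i; rw [Fin.snoc_castSucc]; simp; omega
  · obtain ⟨i, hi⟩ := Function.ne_iff.mp (ha.ne (by decide : (1 : Fin 2) ≠ 0))
    refine ⟨Fin.castSucc i, Fin.last 3, ?_⟩
    simp only [Fin.snoc_castSucc, Fin.snoc_last]
    omega
  · intro z hz
    rw [mem_image] at hz
    obtain ⟨x, hx, rfl⟩ := hz
    refine ⟨?_, ?_, ?_⟩
    · rw [Fin.sum_univ_castSucc]
      simpa only [Fin.snoc_castSucc, Fin.snoc_last, mul_zero, add_zero, Pi.sub_apply]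
        using bisector (hT x hx 0) (hT x hx 1)
    · rw [Fin.sum_univ_castSucc]
      simp only [Fin.snoc_castSucc, Fin.snoc_last, mul_zero, zero_mul, add_zero,
        Finset.sum_const_zero]
    · rw [Fin.sum_univ_castSucc]
      simp only [Fin.snoc_castSucc, Fin.snoc_last]
      simpa using hT x hx 0

theorem statement_12 (d : ℕ) (hd : d = 3 ∨ d = 4) (c : ℝ) (hc : 0 < c)
    (ε : ℝ) (hε : 0 < ε) :
    ∃ C : ℝ, 0 < C ∧
      ∀ m : ℕ, ∀ a : Fin (d - 1) → Fin d → ℤ,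
        Function.Injective a →
        (∀ i j, ((|a i j| : ℤ) : ℝ) ≤ (m : ℝ) ^ c) →
        ((⋂ i, (fun y => a i + y) '' latSphere d m).ncard : ℝ) ≤ C * (m : ℝ) ^ ε := by
  have hc1 : 0 < 2 * c + 1 := by linarith
  obtain ⟨C1, hC1, hP⟩ := plane_bound_gen (ε / (2 * c + 1)) (by positivity)
  refine ⟨C1 * (17 : ℝ) ^ (ε / (2 * c + 1)), by positivity, ?_⟩
  intro m a ha hab
  rcases Nat.eq_zero_or_pos m with rfl | hm
  · exfalso
    have h0 : ∀ i, a i = 0 := by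
      intro i
      funext j
      have := hab i j
      rw [Nat.cast_zero, Real.zero_rpow hc.ne'] at this
      have h3 : |a i j| ≤ 0 := by exact_mod_cast this
      simpa using h3
    have h01 : (⟨0, by omega⟩ : Fin (d - 1)) ≠ ⟨1, by omega⟩ := by simp
    exact ha.ne h01 (by rw [h0, h0])
  obtain ⟨H, hH, hH2, hmH, hlin, hsq⟩ := height_bounds c hc m hm
  have hHr : (1 : ℝ) ≤ H := by exact_mod_cast hH
  by_cases hfin : (⋂ i, (fun y => a i + y) '' latSphere d m).Finite
  swap
  · rw [Set.Infinite.ncard hfin]; simp; positivity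
  rw [Set.ncard_eq_toFinset_card _ hfin]
  have hT : ∀ x ∈ hfin.toFinset, ∀ i, ∑ j, (x j - a i j) ^ 2 = (m : ℤ) := by
    intro x hx
    rw [Set.Finite.mem_toFinset, mem_inter_iff'] at hx
    exact hx
  generalize hfin.toFinset = T at hT
  have main : (#T : ℝ) ≤ C1 * (H : ℝ) ^ (ε / (2 * c + 1)) := by
    rcases hd with rfl | rfl
    · exact three_case m a ha _ C1 H hH (hP H hH) hmH (fun i i' j => hlin _ _ (hab _ _) (hab _ _))
        (fun i i' => hsq 3 (by norm_num) _ _ (hab _) (hab _)) T hT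
    · exact four_case m a ha _ C1 hC1 H hH (hP H hH) hmH
        (fun i i' j => hlin _ _ (hab _ _) (hab _ _))
        (fun i i' => hsq 4 (by norm_num) _ _ (hab _) (hab _)) T hT
  calc (#T : ℝ) ≤ C1 * (H : ℝ) ^ (ε / (2 * c + 1)) := main
    _ ≤ C1 * (17 * (m : ℝ) ^ (2 * c + 1)) ^ (ε / (2 * c + 1)) := by gcongr
    _ = C1 * (17 : ℝ) ^ (ε / (2 * c + 1)) * (m : ℝ) ^ ε := by
        rw [Real.mul_rpow (by norm_num) (by positivity), ← Real.rpow_mul (by positivity),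
          mul_div_cancel₀ _ hc1.ne', mul_assoc]
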